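/- For all integers n and all k ≥ 0 (with the boundary conventions): (k+1)·op_{n+2,k+2}(321) = (4k+4)·(op_{n+1,k+2}(321) - op_{n,k+2}(321)) - (k+2)·op_{n+2,k+1}(321) + (8k+6)·(op_{n+1,k+1}(321) - op_{n,k+1}(321)) + (4k+2)·(op_{n+1,k}(321) - op_{n,k}(321)). -/

import Mathlib

open Finset BigOperators

/-- A word `w` of length `n` over the alphabet `[k]` contains the permutation
pattern `p` of length `m`. -/
def WordContains {n k m : ℕ} (w : Fin n → Fin k) (p : Equiv.Perm (Fin m)) : Prop :=
  ∃ ι : Fin m → Fin n, StrictMono ι ∧ ∀ a b : Fin m, w (ι a) < w (ι b) ↔ p a < p b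

/-- The number of words of length `n` over the alphabet `[k]` avoiding the pattern `p`. -/
noncomputable def wordAvoidCount (n k m : ℕ) (p : Equiv.Perm (Fin m)) : ℕ :=
  Nat.card {w : Fin n → Fin k // ¬ WordContains w p}

/-- An ordered set partition of `[n]` into `k` blocks. -/
structure OrdPartition (n k : ℕ) where
  blocks : Fin k → Finset (Fin n)
  blocks_nonempty : ∀ i, (blocks i).Nonempty
  blocks_disjoint : ∀ i j, i ≠ j → Disjoint (blocks i) (blocks j)
  blocks_cover : ∀ x : Fin n, ∃ i, x ∈ blocks i

/-- An ordered set partition contains the permutation pattern `p`. -/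
def OPContains {n k m : ℕ} (P : OrdPartition n k) (p : Equiv.Perm (Fin m)) : Prop :=
  ∃ ι : Fin m → Fin k, StrictMono ι ∧ ∃ b : Fin m → Fin n,
    (∀ j, b j ∈ P.blocks (ι j)) ∧ ∀ a c : Fin m, b a < b c ↔ p a < p c

/-- The number of ordered set partitions of `[n]` into `k` blocks avoiding `p`. -/
noncomputable def opAvoidCount (n k m : ℕ) (p : Equiv.Perm (Fin m)) : ℕ :=
  Nat.card {P : OrdPartition n k // ¬ OPContains P p}

/-- The pattern 321. -/
def p321 : Equiv.Perm (Fin 3) := Fin.revPerm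

/-- `op_{n,k}(321)` extended to all integers `n`, `k` with the conventions
`op_{n,k} = 0` if `n < k` or `k < 0` or `n < 0`, and `op_{n,0} = δ_{n,0}`. -/
noncomputable def opExt (n k : ℤ) : ℤ :=
  if 0 ≤ n ∧ 0 ≤ k then (opAvoidCount n.toNat k.toNat 3 p321 : ℤ) else 0


/-- The number of ways to append `n` letters to a 321-avoiding word, when `i` letters of the
alphabet lie below its maximum but not below the bottom of any of its descents, and `j` letters
lie above its maximum. -/
def avoidCompletions : ℕ → ℕ → ℕ → ℤ
  | 0, _, _ => 1
  | n + 1, i, j => ∑ d ∈ range (j + 1), avoidCompletions n (i + d) (j - d) +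
      ∑ e ∈ range i, avoidCompletions n (e + 1) j

/-- The word `w` has no strictly decreasing subsequence of length three. -/
def AvoidsDesc {n k : ℕ} (w : Fin n → Fin k) : Prop :=
  ∀ p q r, p < q → q < r → w q < w p → ¬ w r < w q

/-- Appending `w` to a 321-avoiding word with maximum `M`, whose largest letter at the bottom of a
descent is `m`, creates no strictly decreasing subsequence of length three. -/
def AvoidsDescAfter {n k : ℕ} (m M : ℕ) (w : Fin n → Fin k) : Prop :=
  (∀ p, m ≤ w p) ∧ (∀ p q, p < q → w q < w p → M ≤ w p) ∧ AvoidsDesc w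

theorem avoidsDescAfter_zero_zero {n k : ℕ} (w : Fin n → Fin k) :
    AvoidsDescAfter 0 0 w ↔ AvoidsDesc w := by
  simp [AvoidsDescAfter]

theorem avoidsDesc_cons {n k : ℕ} (c : Fin k) (w : Fin n → Fin k) :
    AvoidsDesc (Fin.cons c w : Fin (n + 1) → Fin k) ↔
      (∀ p q, p < q → w q < w p → c ≤ w p) ∧ AvoidsDesc w := by
  simp only [AvoidsDesc, Fin.forall_fin_succ, Fin.cons_zero, Fin.cons_succ, Fin.succ_lt_succ_iff,
    Fin.succ_pos, Fin.not_lt_zero, IsEmpty.forall_iff, implies_true, true_and,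
    forall_const]
  refine and_congr_left fun _ => forall₂_congr fun p q => ?_
  constructor
  · intro h hpq hw
    by_contra! hc
    exact h hpq hc hw
  · intro h hpq hc hw
    exact absurd (h hpq hw) (not_le.mpr hc)

theorem avoidsDescAfter_cons {n k m M : ℕ} (c : Fin k) (w : Fin n → Fin k) :
    AvoidsDescAfter m M (Fin.cons c w : Fin (n + 1) → Fin k) ↔
      m ≤ c ∧ if M ≤ c then AvoidsDescAfter m c w else AvoidsDescAfter c M w := by
  rw [AvoidsDescAfter, avoidsDesc_cons]
  simp only [AvoidsDescAfter, Fin.forall_fin_succ, Fin.cons_zero, Fin.cons_succ,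
    Fin.succ_lt_succ_iff, Fin.succ_pos, Fin.not_lt_zero, IsEmpty.forall_iff,
    true_and, forall_const]
  simp only [Fin.lt_def, Fin.le_def]
  split_ifs with h
  · constructor
    · rintro ⟨⟨h1, h2⟩, ⟨h3, h4⟩, h5, h6⟩
      exact ⟨h1, h2, h5, h6⟩
    · rintro ⟨h1, h2, h5, h6⟩
      exact ⟨⟨h1, h2⟩, ⟨fun _ _ => h, fun p q hp hq => h.trans (h5 p q hp hq)⟩, h5, h6⟩
  · constructor
    · rintro ⟨⟨h1, h2⟩, ⟨h3, h4⟩, h5, h6⟩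
      exact ⟨h1, fun p => by by_contra! hc; exact h (h3 p hc), h4, h6⟩
    · rintro ⟨h1, h2, h4, h6⟩
      exact ⟨⟨h1, fun p => h1.trans (h2 p)⟩, ⟨fun p hp => absurd (h2 p) (not_le.mpr hp), h4⟩,
        fun p q hp hq => by have := h4 p q hp hq; omega, h6⟩

open Classical in
theorem card_avoidsDescAfter_succ (n k m M : ℕ) :
    #{w : Fin (n + 1) → Fin k | AvoidsDescAfter m M w} =
      ∑ c ∈ range k, if m ≤ c then
        if M ≤ c then #{w : Fin n → Fin k | AvoidsDescAfter m c w}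
        else #{w : Fin n → Fin k | AvoidsDescAfter c M w} else 0 := by
  rw [Finset.sum_range]
  simp only [card_filter]
  rw [← (Fin.consEquiv fun _ => Fin k).sum_comp, Fintype.sum_prod_type]
  refine sum_congr rfl fun c _ => ?_
  simp only [Fin.consEquiv, Equiv.coe_fn_mk, avoidsDescAfter_cons]
  by_cases h1 : m ≤ c <;> by_cases h2 : M ≤ c <;> simp [h1, h2]

open Classical in
theorem card_avoidsDescAfter (n m i j : ℕ) :
    (#{w : Fin n → Fin (m + i + (j + 1)) | AvoidsDescAfter m (m + i) w} : ℤ) =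
      avoidCompletions n i j := by
  induction n generalizing m i j with
  | zero => simp [AvoidsDescAfter, AvoidsDesc, avoidCompletions]
  | succ n ih =>
    rw [card_avoidsDescAfter_succ, sum_range_add, sum_range_add,
      sum_eq_zero, zero_add, add_comm]
    · push_cast
      rw [avoidCompletions]
      congr 1
      · refine sum_congr rfl fun d hd => ?_
        have hd := mem_range.mp hd
        rw [if_pos (by omega), if_pos (by omega), ← ih m]
        rw [show m + i + (j + 1) = m + (i + d) + (j - d + 1) by omega, add_assoc m i d]
      · rw [← sum_range_reflect]
        refine sum_congr rfl fun d hd => ?_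
        have hd := mem_range.mp hd
        rw [if_pos (by omega), if_neg (by omega), ← ih (m + (i - 1 - d))]
        rw [show m + (i - 1 - d) + (d + 1) = m + i by omega]
    · intro c hc
      rw [if_neg (by simpa using hc)]

open Classical in
/-- The number of surjective 321-avoiding words of length `n` over the alphabet `[k]`. -/
noncomputable def surjAvoidCount (n k : ℕ) : ℕ :=
  #{w : Fin n → Fin k | Function.Surjective w ∧ AvoidsDesc w}

theorem AvoidsDesc.comp_iff {n k l : ℕ} {w : Fin n → Fin k} {f : Fin k → Fin l}
    (hf : StrictMono f) : AvoidsDesc (f ∘ w) ↔ AvoidsDesc w := by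
  simp [AvoidsDesc, hf.lt_iff_lt]

open Classical in
theorem card_avoidsDesc_image {n k : ℕ} (s : Finset (Fin k)) :
    #{w : Fin n → Fin k | AvoidsDesc w ∧ univ.image w = s} = surjAvoidCount n #s := by
  symm
  have hmono := (s.orderEmbOfFin rfl).strictMono
  refine card_bij (fun w _ => s.orderEmbOfFin rfl ∘ w) ?_ ?_ ?_
  · intro w hw
    simp only [mem_filter, mem_univ, true_and] at hw ⊢
    refine ⟨(AvoidsDesc.comp_iff hmono).mpr hw.2, ?_⟩
    rw [← coe_inj, coe_image, coe_univ, Set.image_univ, hw.1.range_comp, range_orderEmbOfFin]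
  · intro w _ w' _ h
    exact hmono.injective.comp_left h
  · intro w hw
    simp only [mem_filter, mem_univ, true_and] at hw ⊢
    have hr : ∀ x, ∃ y, s.orderEmbOfFin rfl y = w x := fun x => by
      have : w x ∈ Set.range (s.orderEmbOfFin rfl) := by
        rw [range_orderEmbOfFin, ← hw.2]; simp
      exact this
    choose u hu using hr
    have hu' : s.orderEmbOfFin rfl ∘ u = w := funext hu
    refine ⟨u, ⟨fun y => ?_, ?_⟩, hu'⟩
    · have : s.orderEmbOfFin rfl y ∈ univ.image w := by rw [hw.2]; exact orderEmbOfFin_mem s rfl y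
      obtain ⟨x, -, hx⟩ := mem_image.mp this
      exact ⟨x, hmono.injective ((hu x).trans hx)⟩
    · rw [← AvoidsDesc.comp_iff hmono, hu']
      exact hw.1

open Classical in
theorem card_avoidsDesc (n k : ℕ) :
    #{w : Fin n → Fin k | AvoidsDesc w} = ∑ j ∈ range (k + 1), k.choose j * surjAvoidCount n j := by
  rw [card_eq_sum_card_fiberwise (f := fun w => univ.image w) (t := univ.powerset)
    (fun _ _ => by simp)]
  simp only [filter_filter, card_avoidsDesc_image]
  rw [sum_powerset_apply_card (fun j => surjAvoidCount n j)]
  simp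

theorem avoidCompletions_zero (n k : ℕ) :
    avoidCompletions n 0 k =
      ∑ j ∈ range (k + 1), (k.choose j : ℤ) * (surjAvoidCount n j + surjAvoidCount n (j + 1)) := by
  classical
  have h := card_avoidsDescAfter n 0 0 k
  rw [add_zero, zero_add] at h
  simp only [avoidsDescAfter_zero_zero] at h
  rw [← h, card_avoidsDesc]
  push_cast
  simp only [mul_add, sum_add_distrib]
  rw [sum_range_succ' _ (k + 1)]
  simp only [Nat.choose_succ_succ, Nat.cast_add, add_mul, sum_add_distrib]
  rw [sum_range_succ (fun j => (k.choose (j + 1) : ℤ) * _) k,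
    sum_range_succ' (fun j => (k.choose j : ℤ) * (surjAvoidCount n j : ℤ)) k]
  simp
  ring

theorem surjAvoidCount_zero (n : ℕ) : surjAvoidCount n 0 = if n = 0 then 1 else 0 := by
  rcases n with _ | n
  · simp [surjAvoidCount, AvoidsDesc, Function.Surjective]
  · simp [surjAvoidCount]

namespace OrdPartition

/-- The index of the block containing `x`. -/
noncomputable def blockIndex {n k : ℕ} (P : OrdPartition n k) (x : Fin n) : Fin k :=
  (P.blocks_cover x).choose

theorem mem_blocks_iff {n k : ℕ} (P : OrdPartition n k) (x : Fin n) (i : Fin k) :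
    x ∈ P.blocks i ↔ P.blockIndex x = i := by
  have h : x ∈ P.blocks (P.blockIndex x) := (P.blocks_cover x).choose_spec
  refine ⟨fun hx => ?_, fun hi => hi ▸ h⟩
  by_contra hi
  exact disjoint_left.mp (P.blocks_disjoint _ _ hi) h hx

/-- The ordered set partition whose blocks are the fibres of a surjective word. -/
def ofSurjective {n k : ℕ} (w : Fin n → Fin k) (hw : Function.Surjective w) :
    OrdPartition n k where
  blocks i := {x | w x = i}
  blocks_nonempty i := (hw i).imp fun x hx => by simpa using hx
  blocks_disjoint i j h := disjoint_left.mpr fun x hx hy => by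
    simp only [mem_filter, mem_univ, true_and] at hx hy
    exact h (hx.symm.trans hy)
  blocks_cover x := ⟨w x, by simp⟩

/-- Ordered set partitions of `[n]` into `k` blocks correspond to surjective words. -/
noncomputable def equivSurjective (n k : ℕ) :
    OrdPartition n k ≃ {w : Fin n → Fin k // Function.Surjective w} where
  toFun P := ⟨P.blockIndex, fun i =>
    (P.blocks_nonempty i).imp fun x hx => (P.mem_blocks_iff x i).mp hx⟩
  invFun w := ofSurjective w.1 w.2
  left_inv P := by
    have h : (ofSurjective P.blockIndex fun i =>
        (P.blocks_nonempty i).imp fun x hx => (P.mem_blocks_iff x i).mp hx).blocks = P.blocks := by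
      ext i x
      simp [ofSurjective, mem_blocks_iff]
    cases P
    simpa only [ofSurjective, mk.injEq] using h
  right_inv w := Subtype.ext <| funext fun x =>
    (mem_blocks_iff (ofSurjective w.1 w.2) x (w.1 x)).mp (by simp [ofSurjective])

end OrdPartition

theorem opContains_p321_iff {n k : ℕ} (P : OrdPartition n k) :
    ¬ OPContains P p321 ↔ AvoidsDesc P.blockIndex := by
  simp only [OPContains, OrdPartition.mem_blocks_iff]
  set w := P.blockIndex
  constructor
  · intro h p q r hpq hqr h1 h2
    refine h ⟨![w r, w q, w p], ?_, ![r, q, p], ?_, ?_⟩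
    · rw [Fin.strictMono_iff_lt_succ]
      intro i
      fin_cases i <;> simpa
    · intro j
      fin_cases j <;> rfl
    · have := hpq.trans hqr
      intro a c
      fin_cases a <;> fin_cases c <;> simp [p321, *, le_of_lt]
  · rintro h ⟨ι, hι, b, hb, hp⟩
    refine h (b 2) (b 1) (b 0) ((hp _ _).mpr (by decide)) ((hp _ _).mpr (by decide)) ?_ ?_
    · rw [hb, hb]; exact hι (by decide)
    · rw [hb, hb]; exact hι (by decide)

theorem opAvoidCount_p321 (n k : ℕ) : opAvoidCount n k 3 p321 = surjAvoidCount n k := by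
  classical
  rw [opAvoidCount, surjAvoidCount, ← Fintype.card_subtype, ← Nat.card_eq_fintype_card]
  refine Nat.card_congr (((OrdPartition.equivSurjective n k).subtypeEquiv
    (opContains_p321_iff)).trans (Equiv.subtypeSubtypeEquivSubtypeInter _ _))

namespace PowerSeries

theorem avoidCompletions_succ_right (n i j : ℕ) :
    avoidCompletions (n + 1) i (j + 1) - avoidCompletions (n + 1) (i + 1) j =
      avoidCompletions n i (j + 1) + ∑ e ∈ range i, avoidCompletions n (e + 1) (j + 1) -
        ∑ e ∈ range (i + 1), avoidCompletions n (e + 1) j := by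
  simp only [avoidCompletions]
  rw [sum_range_succ' _ (j + 1)]
  have : ∀ d, avoidCompletions n (i + (d + 1)) (j + 1 - (d + 1)) =
      avoidCompletions n (i + 1 + d) (j - d) := fun d => by
    rw [Nat.add_sub_add_right, add_assoc, add_comm 1 d]
  simp only [this, add_zero, Nat.sub_zero]
  ring

/-- The generating function of `avoidCompletions · i ·`: the inner variable marks the length, the
outer one the number of letters above the maximum. -/
noncomputable def completionSeries (i : ℕ) : PowerSeries (PowerSeries ℤ) :=
  mk fun j => mk fun n => avoidCompletions n i j

theorem completionSeries_zero :
    (1 - C (X : PowerSeries ℤ)) * (completionSeries 0 - X * completionSeries 1) = 1 := by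
  have : (1 - C (X : PowerSeries ℤ)) * (completionSeries 0 - X * completionSeries 1) =
    completionSeries 0 - X * completionSeries 1 - C X * completionSeries 0 
    + X * (C X * completionSeries 1) := by ring
  rw [this]
  ext j n
  rcases j with _ | j <;> rcases n with _ | n <;>
    simp [completionSeries, coeff_succ_X_mul, coeff_one]
  · simp [avoidCompletions]
  · simp [avoidCompletions]
  · simp [avoidCompletions]
  · have := avoidCompletions_succ_right n 0 j
    simp at this
    linarith

theorem completionSeries_add_two (i : ℕ) :
    (1 - C (X : PowerSeries ℤ)) * X * completionSeries (i + 2) =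
      (1 + X - 2 * C X) * completionSeries (i + 1) - (1 - C X) * completionSeries i := by
  have h : X * completionSeries (i + 2) + C X * completionSeries (i + 1) +
        C X * completionSeries (i + 1) + completionSeries i =
      completionSeries (i + 1) + X * completionSeries (i + 1) +
        X * (C X * completionSeries (i + 2)) + C X * completionSeries i := by
    ext j n
    rcases j with _ | j <;> rcases n with _ | n <;>
      simp [completionSeries, coeff_succ_X_mul]
    · simp [avoidCompletions]
    · simp [avoidCompletions, sum_range_succ]; ring
    · simp [avoidCompletions]
    · have h0 := avoidCompletions_succ_right n i j
      have h1 := avoidCompletions_succ_right n (i + 1) j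
      rw [sum_range_succ] at h0
      rw [sum_range_succ _ (i + 1), sum_range_succ _ i, sum_range_succ _ i] at h1
      simp only [add_assoc, Nat.reduceAdd] at h0 h1 ⊢
      linarith
  linear_combination h

theorem one_sub_C_X_ne_zero : (1 - C (X : PowerSeries ℤ)) ≠ 0 := by
  intro h
  have := congrArg (fun f => constantCoeff (constantCoeff f)) h
  simp at this

theorem completionSeries_det : completionSeries 0 * completionSeries 2 = completionSeries 1 ^ 2 := by
  set D : ℕ → PowerSeries (PowerSeries ℤ) := fun i =>
    completionSeries i * completionSeries (i + 2) - completionSeries (i + 1) ^ 2 with hD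
  have step : ∀ i, D i = X * D (i + 1) := fun i => by
    apply mul_left_cancel₀ one_sub_C_X_ne_zero
    have h0 := completionSeries_add_two i
    have h1 := completionSeries_add_two (i + 1)
    simp only [hD]
    simp only [add_assoc, Nat.reduceAdd] at h0 h1 ⊢
    linear_combination completionSeries (i + 2) * h0 - completionSeries (i + 1) * h1
  have pow : ∀ i, D 0 = X ^ i * D i := fun i => by
    induction i with
    | zero => simp
    | succ i ih => rw [ih, step i, pow_succ, mul_assoc]
  have : D 0 = 0 := by
    ext1 j
    rw [pow (j + 1), coeff_X_pow_mul']
    simp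
  exact sub_eq_zero.mp this

theorem completionSeries_quadratic :
    C (X * (1 - X)) * (1 - X) * completionSeries 0 ^ 2 - (1 - X) * completionSeries 0 + 1 = 0 := by
  have h0 := completionSeries_zero
  have h1 := completionSeries_add_two 0
  have h2 := completionSeries_det
  simp only [map_mul, map_sub, map_one, zero_add] at *
  set x : PowerSeries (PowerSeries ℤ) := C X
  set F := completionSeries 0
  set G := completionSeries 1
  set K := completionSeries 2
  set t : PowerSeries (PowerSeries ℤ) := X
  have e : (1 - x) * (t * G) = (1 - x) * F - 1 := by linear_combination -h0
  have q : (1 - x) * t * G ^ 2 = (1 + t - 2 * x) * F * G - (1 - x) * F ^ 2 := by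
    linear_combination F * h1 - (1 - x) * t * h2
  linear_combination (1 - x) * t * q - ((1 - x) * (t * G) + (1 - x) * F - 1) * e +
    (1 + t - 2 * x) * F * e

/-- The power series whose `k`-th coefficient is `∑ j, k.choose j * coeff j f`. -/
noncomputable def binomialTransform {R : Type*} [CommRing R] (f : PowerSeries R) : PowerSeries R :=
  mk fun k => ∑ j ∈ range (k + 1), (k.choose j : R) * coeff j f

section
variable {R : Type*} [CommRing R]

theorem hasSubst_X_mul_mk_one : HasSubst (X * mk 1 : PowerSeries R) :=
  HasSubst.of_constantCoeff_zero' (by simp)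

theorem coeff_mk_one_mul_pow (k d : ℕ) :
    coeff k (mk 1 * (X * mk 1) ^ d : PowerSeries R) = (k.choose d : R) := by
  have : (mk 1 * (X * mk 1) ^ d : PowerSeries R) = X ^ d * (mk 1) ^ (d + 1) := by ring
  rw [this, coeff_X_pow_mul', mk_one_pow_eq_mk_choose_add]
  split_ifs with h
  · simp [Nat.add_sub_cancel' h]
  · simp [Nat.choose_eq_zero_of_lt (not_le.mp h)]

theorem mk_one_mul_subst (f : PowerSeries R) :
    mk 1 * f.subst (X * mk 1 : PowerSeries R) = binomialTransform f := by
  ext k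
  have hc : ∀ m ≤ k, coeff m (f.subst (X * mk 1 : PowerSeries R)) =
      ∑ d ∈ range (k + 1), coeff d f * coeff m ((X * mk 1 : PowerSeries R) ^ d) := by
    intro m hm
    rw [coeff_subst' hasSubst_X_mul_mk_one, finsum_eq_sum_of_support_subset (s := range (k + 1))]
    · simp
    · intro d hd
      simp only [coe_range, Set.mem_Iio]
      by_contra! h
      apply hd
      simp only
      rw [mul_pow, coeff_X_pow_mul', if_neg (by omega), smul_zero]
  rw [coeff_mul, binomialTransform, coeff_mk]
  rw [sum_congr rfl fun p hp => by
    rw [hc p.2 (by have := mem_antidiagonal.mp hp; omega), mul_sum]]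
  rw [sum_comm]
  refine sum_congr rfl fun d _ => ?_
  rw [← coeff_mk_one_mul_pow, coeff_mul, sum_mul]
  exact sum_congr rfl fun p _ => by ring

theorem eq_zero_of_binomialTransform_eq_zero {f : PowerSeries R}
    (h : binomialTransform f = 0) : f = 0 := by
  ext k
  induction k using Nat.strong_induction_on with
  | _ k ih =>
    have := congrArg (coeff k) h
    rw [binomialTransform, coeff_mk, sum_range_succ, sum_eq_zero] at this
    · simpa using this
    · intro j hj
      simp [ih j (mem_range.mp hj)]

theorem quadratic_of_binomialTransform {v : R} {f : PowerSeries R}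
    (h : C v * (1 - X) * binomialTransform f ^ 2 - (1 - X) * binomialTransform f + 1 = 0) :
    C v * (1 + X) * f ^ 2 - f + 1 = 0 := by
  have hg : (mk 1 : PowerSeries R) * (1 - X) = 1 := mk_one_mul_one_sub_eq_one R
  apply eq_zero_of_binomialTransform_eq_zero
  rw [← mk_one_mul_subst] at h ⊢
  have hC : (C v : PowerSeries R).subst (X * mk 1 : PowerSeries R) = C v := subst_C v
  have hX := subst_X (R := R) (hasSubst_X_mul_mk_one (R := R))
  have e : (C v * (1 + X) * f ^ 2 - f + 1).subst (X * mk 1 : PowerSeries R) =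
      C v * (1 + X * mk 1) * f.subst (X * mk 1 : PowerSeries R) ^ 2
        - f.subst (X * mk 1 : PowerSeries R) + 1 := by
    rw [← coe_substAlgHom hasSubst_X_mul_mk_one] at hC hX ⊢
    simp only [map_add, map_sub, map_mul, map_pow, map_one, hC, hX]
  rw [e]
  set g : PowerSeries R := mk 1
  set s := f.subst (X * g : PowerSeries R)
  linear_combination g * h + (g * s - C v * g * s ^ 2 - C v * g ^ 2 * s ^ 2) * hg

end

theorem recurrence_of_quadratic {v : PowerSeries ℤ} (hv : constantCoeff v = 0)
    (a : ℕ → PowerSeries ℤ) (ha : a 0 = 1)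
    (h : C v * (1 + X) * (mk fun k => a k + a (k + 1)) ^ 2 - (mk fun k => a k + a (k + 1)) + 1 = 0)
    (k : ℕ) :
    ((k : PowerSeries ℤ) + 1) * a (k + 2) =
      (4 * (k : PowerSeries ℤ) + 4) * (v * a (k + 2)) - ((k : PowerSeries ℤ) + 2) * a (k + 1) +
        (8 * (k : PowerSeries ℤ) + 6) * (v * a (k + 1)) +
        (4 * (k : PowerSeries ℤ) + 2) * (v * a k) := by
  set B : PowerSeries (PowerSeries ℤ) := mk fun k => a k + a (k + 1) with hB
  set A : PowerSeries (PowerSeries ℤ) := mk fun k => a (k + 1) with hA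
  have hBA : B = 1 + (1 + X) * A := by
    rw [add_mul, one_mul]
    ext1 k
    rcases k with _ | k
    · simp [hB, hA, ha]
    · simp [hB, hA, coeff_succ_X_mul, coeff_one, add_comm]
  set B' := d⁄dX (PowerSeries ℤ) B with hB'
  have hd : (2 * C v * (1 + X) * B - 1) * B' + C v * B ^ 2 = 0 := by
    have := congrArg (d⁄dX (PowerSeries ℤ)) h
    simp only [map_add, map_sub, Derivation.leibniz, Derivation.leibniz_pow, derivative_C,
      derivative_X, Derivation.map_one_eq_zero, map_zero, smul_eq_mul, nsmul_eq_mul] at this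
    push_cast at this
    linear_combination this
  have hu : (2 * C v * (1 + X) * B - 1) ≠ 0 := fun h0 => by
    have := congrArg (fun f => constantCoeff (constantCoeff f)) h0
    simp [hv] at this
  have hX : (1 + X : PowerSeries (PowerSeries ℤ)) ≠ 0 := fun h0 => by
    have := congrArg constantCoeff h0
    simp at this
  have ode : B' + A = C v * (4 * B' + 4 * (X * B') + 2 * B) := by
    apply mul_left_cancel₀ hX
    apply mul_left_cancel₀ hu
    linear_combination (1 + X) * (1 - 4 * C v * (1 + X)) * hd + h -
      (2 * C v * (1 + X) * B - 1) * hBA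
  have hk := congrArg (coeff k) ode
  have e : C v * (4 * B' + 4 * (X * B') + 2 * B) = C (4 * v) * B' + C (4 * v) * (X * B')
      + C (2 * v) * B := by
    simp only [map_mul, map_ofNat]; ring
  rw [e] at hk
  simp only [map_add, coeff_C_mul] at hk
  have hXB : coeff k (X * B') = k * coeff k B := by
    rcases k with _ | k
    · simp
    · rw [coeff_succ_X_mul, hB', coeff_derivative]; push_cast; ring
  rw [hXB, hB', coeff_derivative, hB, hA, coeff_mk, coeff_mk, coeff_mk] at hk
  linear_combination hk

end PowerSeries

/-- The generating function of `surjAvoidCount · k`. -/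
noncomputable def opSeries (k : ℕ) : PowerSeries ℤ :=
  PowerSeries.mk fun n => (surjAvoidCount n k : ℤ)

theorem opSeries_zero : opSeries 0 = 1 := by
  ext n
  simp [opSeries, surjAvoidCount_zero, PowerSeries.coeff_one]

theorem completionSeries_zero_eq_binomialTransform :
    PowerSeries.completionSeries 0 =
      PowerSeries.binomialTransform (PowerSeries.mk fun k => opSeries k + opSeries (k + 1)) := by
  ext k n
  simp only [PowerSeries.completionSeries, PowerSeries.binomialTransform, PowerSeries.coeff_mk,
    avoidCompletions_zero, map_sum]
  refine sum_congr rfl fun j _ => ?_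
  rw [← map_natCast (PowerSeries.C (R := ℤ)), PowerSeries.coeff_C_mul]
  simp [opSeries]

theorem opSeries_recurrence (k : ℕ) :
    ((k : PowerSeries ℤ) + 1) * opSeries (k + 2) =
      (4 * (k : PowerSeries ℤ) + 4) * (PowerSeries.X * (1 - PowerSeries.X) * opSeries (k + 2)) -
        ((k : PowerSeries ℤ) + 2) * opSeries (k + 1) +
        (8 * (k : PowerSeries ℤ) + 6) *
          (PowerSeries.X * (1 - PowerSeries.X) * opSeries (k + 1)) +
        (4 * (k : PowerSeries ℤ) + 2) * (PowerSeries.X * (1 - PowerSeries.X) * opSeries k) := by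
  refine PowerSeries.recurrence_of_quadratic (by simp) opSeries opSeries_zero ?_ k
  apply PowerSeries.quadratic_of_binomialTransform
  rw [← completionSeries_zero_eq_binomialTransform]
  exact PowerSeries.completionSeries_quadratic

theorem opExt_natCast (n k : ℕ) : opExt n k = PowerSeries.coeff n (opSeries k) := by
  simp [opExt, opSeries, opAvoidCount_p321]

theorem opExt_of_neg {n : ℤ} (hn : n < 0) (k : ℤ) : opExt n k = 0 :=
  if_neg fun h => absurd h.1 (not_le.mpr hn)

theorem coeff_X_mul_one_sub_X_mul_opSeries (n k : ℕ) :
    PowerSeries.coeff n (PowerSeries.X * (1 - PowerSeries.X) * opSeries k) =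
      opExt (n - 1) k - opExt (n - 2) k := by
  rw [mul_assoc, sub_mul, one_mul]
  rcases n with _ | _ | n
  · simp [opExt_of_neg]
  · rw [PowerSeries.coeff_succ_X_mul, map_sub, ← opExt_natCast, opExt_of_neg (n := _ - 2) (by simp)]
    simp
  · rw [PowerSeries.coeff_succ_X_mul, map_sub, PowerSeries.coeff_succ_X_mul, ← opExt_natCast,
      ← opExt_natCast]
    congr 2 <;> push_cast <;> ring

theorem opExt_recurrence_natCast (n k : ℕ) :
    ((k : ℤ) + 1) * opExt n (k + 2) =
      (4 * (k : ℤ) + 4) * (opExt (n - 1) (k + 2) - opExt (n - 2) (k + 2))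
        - ((k : ℤ) + 2) * opExt n (k + 1)
        + (8 * (k : ℤ) + 6) * (opExt (n - 1) (k + 1) - opExt (n - 2) (k + 1))
        + (4 * (k : ℤ) + 2) * (opExt (n - 1) k - opExt (n - 2) k) := by
  have hC (a b : ℕ) (f : PowerSeries ℤ) : PowerSeries.coeff n
      (((a : PowerSeries ℤ) * (k : PowerSeries ℤ) + (b : PowerSeries ℤ)) * f) =
        ((a : ℤ) * k + b) * PowerSeries.coeff n f := by
    rw [← PowerSeries.coeff_C_mul]; simp
  have h := congrArg (PowerSeries.coeff n) (opSeries_recurrence k)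
  have h1 := hC 1 1
  have h2 := hC 1 2
  have h3 := hC 4 4
  have h4 := hC 8 6
  have h5 := hC 4 2
  push_cast at h1 h2 h3 h4 h5
  simp only [one_mul] at h1 h2
  rw [map_add, map_add, map_sub, h1, h2, h3, h4, h5] at h
  simp only [coeff_X_mul_one_sub_X_mul_opSeries, ← opExt_natCast] at h
  exact_mod_cast h

theorem op_321_double_recurrence_two (n : ℤ) (k : ℕ) :
    ((k : ℤ) + 1) * opExt (n + 2) (k + 2) =
      (4 * (k : ℤ) + 4) * (opExt (n + 1) (k + 2) - opExt n (k + 2))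
        - ((k : ℤ) + 2) * opExt (n + 2) (k + 1)
        + (8 * (k : ℤ) + 6) * (opExt (n + 1) (k + 1) - opExt n (k + 1))
        + (4 * (k : ℤ) + 2) * (opExt (n + 1) k - opExt n k) := by
  rcases lt_or_ge (n + 2) 0 with h | h
  · simp [opExt_of_neg h, opExt_of_neg (n := n + 1) (by omega), opExt_of_neg (n := n) (by omega)]
  · obtain ⟨m, hm⟩ := Int.eq_ofNat_of_zero_le h
    have := opExt_recurrence_natCast m k
    rwa [← hm, show n + 2 - 1 = n + 1 by ring, add_sub_cancel_right] at this
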